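/- For any finite family (M̄_i)_{i=1,…,k} of nonzero multifiltered vector spaces over a field K, one has μ_max(M̄_1 ⊗ ⋯ ⊗ M̄_k) = Σ_{i=1}^k μ_max(M̄_i). -/

import Mathlib

noncomputable section

/-- The dimension of the graded piece `gr^λ M = F^{≥λ}M / F^{>λ}M` of a filtration `Fv`
of the `K`-vector space `M` (where `F^{>λ}M = ⨆_{λ' > λ} F^{≥λ'}M`). -/
def grDim (K : Type) {M : Type} [Field K] [AddCommGroup M] [Module K M]
    (Fv : ℝ → Submodule K M) (lam : ℝ) : ℕ :=
  Module.finrank K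
    (↥(Fv lam) ⧸ Submodule.comap (Fv lam).subtype (⨆ l, ⨆ (_ : lam < l), Fv l))

/-- The slope of a multifiltered space `(M, (F v)_{v})`:
`μ = (1/dim M) · ∑_v ∑_λ λ · dim gr_{F_v}^λ M`. -/
def mfMu (K : Type) (M : Type) [Field K] [AddCommGroup M] [Module K M] {n : ℕ}
    (F : Fin n → ℝ → Submodule K M) : ℝ :=
  (∑ v, ∑ᶠ lam : ℝ, lam * grDim K (F v) lam) / Module.finrank K M

/-- The maximal slope of a multifiltered space: the supremum of the slopes of its nonzero
subspaces, equipped with the induced filtrations `F_v^{≥λ}N = N ⊓ F_v^{≥λ}M`. -/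
def mfMuMax (K : Type) (M : Type) [Field K] [AddCommGroup M] [Module K M] {n : ℕ}
    (F : Fin n → ℝ → Submodule K M) : ℝ :=
  sSup { x : ℝ | ∃ N : Submodule K M, N ≠ ⊥ ∧
    x = mfMu K ↥N (fun v l => (F v l).comap N.subtype) }

/-- A family of `n` decreasing, exhaustive, separated, left-continuous filtrations of `M`
indexed by `ℝ`, making `M` a multifiltered space. -/
def IsMultiFiltration (K : Type) {M : Type} [Field K] [AddCommGroup M] [Module K M] {n : ℕ}
    (F : Fin n → ℝ → Submodule K M) : Prop :=
  (∀ v, Antitone (F v)) ∧ (∀ v, (⨆ l, F v l) = ⊤) ∧ (∀ v, (⨅ l, F v l) = ⊥) ∧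
    (∀ v l, F v l = ⨅ l', ⨅ (_ : l' < l), F v l')

end

open scoped TensorProduct

section Filtrations

open Module Submodule

/-- Abel summation: if the partial sums of `x` over the superlevel sets of a nonnegative `y` are
nonnegative, then so is `∑ x j * y j`. -/
theorem sum_mul_nonneg_of_superlevel {J : Type*} [Fintype J] (x y : J → ℝ) (hy : ∀ j, 0 ≤ y j)
    (h : ∀ t, 0 ≤ ∑ j, if t ≤ y j then x j else 0) : 0 ≤ ∑ j, x j * y j := by
  obtain ⟨C, hC⟩ : ∃ C, ∀ j, y j ≤ C := by
    obtain ⟨C, hC⟩ := (Set.finite_range y).bddAbove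
    exact ⟨C, fun j => hC ⟨j, rfl⟩⟩
  have key : ∀ j, IntervalIntegrable (fun t => if t ≤ y j then x j else 0)
      MeasureTheory.volume 0 (max C 0) ∧
      ∫ t in (0 : ℝ)..(max C 0), (if t ≤ y j then x j else 0) = x j * y j := by
    intro j
    have hyC : y j ≤ max C 0 := (hC j).trans (le_max_left _ _)
    have i1 : IntervalIntegrable (fun t => if t ≤ y j then x j else 0)
        MeasureTheory.volume 0 (y j) := by
      refine (intervalIntegrable_const (c := x j)).congr ?_
      intro t ht
      rw [Set.uIoc_of_le (hy j)] at ht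
      simp [ht.2]
    have i2 : IntervalIntegrable (fun t => if t ≤ y j then x j else 0)
        MeasureTheory.volume (y j) (max C 0) := by
      refine (intervalIntegrable_const (c := (0 : ℝ))).congr ?_
      intro t ht
      rw [Set.uIoc_of_le hyC] at ht
      simp [ht.1]
    refine ⟨i1.trans i2, ?_⟩
    rw [← intervalIntegral.integral_add_adjacent_intervals i1 i2]
    have e1 : ∫ t in (0 : ℝ)..(y j), (if t ≤ y j then x j else 0) = ∫ t in (0 : ℝ)..(y j), x j := by
      refine intervalIntegral.integral_congr_ae (.of_forall fun t ht => ?_)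
      rw [Set.uIoc_of_le (hy j)] at ht
      simp [ht.2]
    have e2 : ∫ t in (y j)..(max C 0), (if t ≤ y j then x j else 0)
        = ∫ t in (y j)..(max C 0), (0 : ℝ) := by
      refine intervalIntegral.integral_congr_ae (.of_forall fun t ht => ?_)
      rw [Set.uIoc_of_le hyC] at ht
      simp [ht.1]
    rw [e1, e2]
    simp [mul_comm]
  rw [← Finset.sum_congr rfl fun j _ => (key j).2,
    ← intervalIntegral.integral_finsetSum fun j _ => (key j).1]
  exact intervalIntegral.integral_nonneg (le_max_right _ _) fun t _ => h t

theorem sum_le_sum_of_card_superlevel {J J' : Type*} [Fintype J] [Fintype J'] (y : J → ℝ)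
    (y' : J' → ℝ) (hc : Fintype.card J = Fintype.card J')
    (h : ∀ t, Nat.card {j // t ≤ y j} ≤ Nat.card {j // t ≤ y' j}) : ∑ j, y j ≤ ∑ j, y' j := by
  obtain ⟨c, hc1, hc2⟩ : ∃ c, (∀ j, c ≤ y j) ∧ ∀ j, c ≤ y' j := by
    obtain ⟨a, ha⟩ := (Set.finite_range y).bddBelow
    obtain ⟨b, hb⟩ := (Set.finite_range y').bddBelow
    exact ⟨min a b, fun j => (min_le_left _ _).trans (ha ⟨j, rfl⟩),
      fun j => (min_le_right _ _).trans (hb ⟨j, rfl⟩)⟩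
  have := sum_mul_nonneg_of_superlevel (J := J ⊕ J') (Sum.elim (fun _ => -1) (fun _ => 1))
    (Sum.elim (fun j => y j - c) (fun j => y' j - c)) (by
      rintro (j | j)
      · simpa using hc1 j
      · simpa using hc2 j) (by
      intro t
      have ht := h (t + c)
      rw [Nat.card_eq_fintype_card, Nat.card_eq_fintype_card, Fintype.card_subtype,
        Fintype.card_subtype, ← @Nat.cast_le ℝ, Finset.natCast_card_filter,
        Finset.natCast_card_filter] at ht
      have e : ∀ a : ℝ, t ≤ a - c ↔ t + c ≤ a := fun a => by
        constructor <;> intro <;> linarith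
      have e' : ∀ j, (if t + c ≤ y j then (-1 : ℝ) else 0) = -(if t + c ≤ y j then 1 else 0) := by
        intro j; split_ifs <;> simp
      simp only [Fintype.sum_sum_type, Sum.elim_inl, Sum.elim_inr, e, e', Finset.sum_neg_distrib]
      linarith)
  simp only [Fintype.sum_sum_type, Sum.elim_inl, Sum.elim_inr, neg_mul, one_mul,
    Finset.sum_neg_distrib, Finset.sum_sub_distrib, Finset.sum_const, Finset.card_univ, hc] at this
  linarith

theorem sum_comp_eq_of_card_superlevel {J J' : Type} [Fintype J] [Fintype J'] (y : J → ℝ)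
    (y' : J' → ℝ) (h : ∀ t, Nat.card {j // t ≤ y j} = Nat.card {j // t ≤ y' j}) (f : ℝ → ℝ) :
    ∑ j, f (y j) = ∑ j, f (y' j) := by
  classical
  have hcard : ∀ t, Finset.card {j | y j = t} = Finset.card {j | y' j = t} := by
    intro t
    obtain ⟨s, hs, hs1, hs2⟩ :
        ∃ s, t < s ∧ (∀ j, t < y j → s ≤ y j) ∧ ∀ j, t < y' j → s ≤ y' j := by
      let S := insert (t + 1) ((Finset.univ.image (Sum.elim y y')).filter (t < ·))
      have hS : S.Nonempty := Finset.insert_nonempty _ _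
      refine ⟨S.min' hS, ?_, fun j hj => S.min'_le _ ?_, fun j hj => S.min'_le _ ?_⟩
      · rw [Finset.lt_min'_iff]
        intro a ha
        rcases Finset.mem_insert.1 ha with rfl | ha
        · linarith
        · exact (Finset.mem_filter.1 ha).2
      · exact Finset.mem_insert_of_mem
          (Finset.mem_filter.2 ⟨Finset.mem_image.2 ⟨.inl j, Finset.mem_univ _, rfl⟩, hj⟩)
      · exact Finset.mem_insert_of_mem
          (Finset.mem_filter.2 ⟨Finset.mem_image.2 ⟨.inr j, Finset.mem_univ _, rfl⟩, hj⟩)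
    have e : ∀ {J : Type} [Fintype J] (y : J → ℝ), (∀ j, t < y j → s ≤ y j) →
        Finset.card {j | y j = t} + Nat.card {j // s ≤ y j} = Nat.card {j // t ≤ y j} := by
      intro J _ y hy
      rw [Nat.card_eq_fintype_card, Nat.card_eq_fintype_card, Fintype.card_subtype,
        Fintype.card_subtype, ← Finset.card_union_of_disjoint]
      · congr 1
        ext j
        simp only [Finset.mem_union, Finset.mem_filter, Finset.mem_univ, true_and]
        constructor
        · rintro (h | h) <;> linarith
        · intro h
          rcases h.eq_or_lt with h | h
          · exact .inl h.symm
          · exact .inr (hy j h)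
      · rw [Finset.disjoint_left]
        intro j hj hj'
        simp only [Finset.mem_filter, Finset.mem_univ, true_and] at hj hj'
        linarith
    have h1 := e y hs1
    have h2 := e y' hs2
    rw [h, h] at h1
    omega
  have e : ∀ {J : Type} [Fintype J] (y : J → ℝ) (S : Finset ℝ), (∀ j, y j ∈ S) →
      ∑ j, f (y j) = ∑ t ∈ S, (Finset.card {j | y j = t}) • f t := by
    intro J _ y S hS
    rw [Finset.sum_comp f y]
    refine Finset.sum_subset (fun t ht => ?_) fun t _ ht => ?_
    · obtain ⟨j, _, rfl⟩ := Finset.mem_image.1 ht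
      exact hS j
    · rw [Finset.card_eq_zero.2, zero_smul]
      ext j
      simp only [Finset.mem_image, not_exists] at ht
      simpa using fun h => ht j ⟨Finset.mem_univ _, h⟩
  have hS := e y (Finset.univ.image (Sum.elim y y'))
    fun j => Finset.mem_image.2 ⟨.inl j, Finset.mem_univ _, rfl⟩
  have hS' := e y' (Finset.univ.image (Sum.elim y y'))
    fun j => Finset.mem_image.2 ⟨.inr j, Finset.mem_univ _, rfl⟩
  rw [hS, hS']
  exact Finset.sum_congr rfl fun t _ => by rw [hcard]

variable {K : Type} [Field K]

/-- The total degree `∑ λ * dim gr^λ` of a filtration. -/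
noncomputable def filDeg {M : Type} [AddCommGroup M] [Module K M] (F : ℝ → Submodule K M) : ℝ :=
  ∑ᶠ lam : ℝ, lam * grDim K F lam

/-- The filtration induced on a subspace. -/
def inducedFil {M : Type} [AddCommGroup M] [Module K M] (F : ℝ → Submodule K M)
    (N : Submodule K M) (l : ℝ) : Submodule K N :=
  (F l).comap N.subtype

/-- The filtration of a space for which the basis vector `b i` has weight `w i`. -/
def weightFil {ι M : Type} [AddCommGroup M] [Module K M] (b : Basis ι K M) (w : ι → ℝ) (l : ℝ) :
    Submodule K M :=
  span K (b '' {i | l ≤ w i})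

/-- The filtration axioms, in the form they take on finite-dimensional spaces. -/
structure IsFil {M : Type} [AddCommGroup M] [Module K M] (F : ℝ → Submodule K M) : Prop where
  antitone : Antitone F
  exists_eq_top : ∃ c, F c = ⊤
  exists_eq_bot : ∃ c, F c = ⊥
  exists_lt_eq : ∀ l, ∃ l' < l, F l' = F l

section

variable {M : Type} [AddCommGroup M] [Module K M]

theorem Antitone.exists_forall_filtration_le [FiniteDimensional K M] {F : ℝ → Submodule K M}
    (hF : Antitone F) {S : Set ℝ} (hS : S.Nonempty) : ∃ a ∈ S, ∀ b ∈ S, F a ≤ F b := by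
  obtain ⟨_, ⟨a, ha, rfl⟩, hmin⟩ := wellFounded_lt.has_min (F '' S) (hS.image F)
  refine ⟨a, ha, fun b hb => ?_⟩
  rcases le_total b a with h | h
  · exact hF h
  · exact ((hF h).eq_or_lt.resolve_right (hmin _ ⟨b, hb, rfl⟩)).ge

theorem Antitone.exists_forall_le_filtration [FiniteDimensional K M] {F : ℝ → Submodule K M}
    (hF : Antitone F) {S : Set ℝ} (hS : S.Nonempty) : ∃ a ∈ S, ∀ b ∈ S, F b ≤ F a := by
  obtain ⟨_, ⟨a, ha, rfl⟩, hmax⟩ := wellFounded_gt.has_min (F '' S) (hS.image F)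
  refine ⟨a, ha, fun b hb => ?_⟩
  rcases le_total a b with h | h
  · exact hF h
  · exact ((hF h).eq_or_lt.resolve_right (hmax _ ⟨b, hb, rfl⟩)).ge

theorem IsMultiFiltration.isFil [FiniteDimensional K M] {n : ℕ} {F : Fin n → ℝ → Submodule K M}
    (hF : IsMultiFiltration K F) (v : Fin n) : IsFil (F v) := by
  obtain ⟨h1, h2, h3, h4⟩ := hF
  refine ⟨h1 v, ?_, ?_, fun l => ?_⟩
  · obtain ⟨a, -, ha⟩ := (h1 v).exists_forall_le_filtration Set.univ_nonempty
    exact ⟨a, top_unique (h2 v ▸ iSup_le fun b => ha b trivial)⟩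
  · obtain ⟨a, -, ha⟩ := (h1 v).exists_forall_filtration_le Set.univ_nonempty
    exact ⟨a, bot_unique (h3 v ▸ le_iInf fun b => ha b trivial)⟩
  · obtain ⟨a, hal, ha⟩ := (h1 v).exists_forall_filtration_le (S := Set.Iio l) ⟨l - 1, by simp⟩
    refine ⟨a, hal, le_antisymm ?_ (h1 v (le_of_lt hal))⟩
    rw [h4 v l]
    exact le_iInf₂ fun b hb => ha b hb

theorem IsFil.induced {F : ℝ → Submodule K M} (hF : IsFil F) (N : Submodule K M) :
    IsFil (inducedFil F N) where
  antitone _ _ h := comap_mono (hF.antitone h)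
  exists_eq_top := hF.exists_eq_top.imp fun c hc => by simp [inducedFil, hc]
  exists_eq_bot := hF.exists_eq_bot.imp fun c hc => by simp [inducedFil, hc]
  exists_lt_eq l := by
    obtain ⟨a, hal, ha⟩ := hF.exists_lt_eq l
    exact ⟨a, hal, by simp [inducedFil, ha]⟩

/-- A left-continuous filtration has a last step that is not contained in a given subspace. -/
theorem IsFil.exists_last_not_le {F : ℝ → Submodule K M} (hF : IsFil F) {H : Submodule K M}
    (hH : H ≠ ⊤) : ∃ l, ¬ F l ≤ H ∧ ∀ l', l < l' → F l' ≤ H := by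
  obtain ⟨c, hc⟩ := hF.exists_eq_top
  obtain ⟨C, hC⟩ := hF.exists_eq_bot
  have hne : {l | ¬ F l ≤ H}.Nonempty := ⟨c, by simpa [hc] using hH⟩
  have hbd : BddAbove {l | ¬ F l ≤ H} := ⟨C, fun l hl => by
    by_contra! h
    exact hl ((hF.antitone h.le).trans (by simp [hC]))⟩
  refine ⟨sSup {l | ¬ F l ≤ H}, fun h => ?_, fun l' hl' => ?_⟩
  · obtain ⟨a, ha, ha'⟩ := hF.exists_lt_eq (sSup {l | ¬ F l ≤ H})
    obtain ⟨b, hb, hab⟩ := exists_lt_of_lt_csSup hne ha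
    exact hb ((hF.antitone hab.le).trans (ha'.le.trans h))
  · by_contra h
    exact (le_csSup hbd h).not_gt hl'

theorem weightFil_isFil {ι : Type} [Finite ι] (b : Basis ι K M) (w : ι → ℝ) :
    IsFil (weightFil b w) := by
  obtain ⟨C, hC⟩ := (Set.finite_range w).bddAbove
  obtain ⟨c, hc⟩ := (Set.finite_range w).bddBelow
  refine ⟨fun l l' h => span_mono (Set.image_mono fun i hi => h.trans hi), ⟨c, ?_⟩, ⟨C + 1, ?_⟩,
    fun l => ?_⟩
  · have : {i | c ≤ w i} = Set.univ := Set.eq_univ_of_forall fun i => hc ⟨i, rfl⟩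
    simp [weightFil, this]
  · have : {i | C + 1 ≤ w i} = ∅ := Set.eq_empty_of_forall_notMem fun i hi => by
      have h1 := hC ⟨i, rfl⟩
      have h2 : C + 1 ≤ w i := hi
      linarith
    simp [weightFil, this]
  · obtain ⟨l', hl', h⟩ : ∃ l' < l, ∀ i, w i < l → w i < l' := by
      have hfin : ({a ∈ Set.range w | a < l}).Finite := (Set.finite_range w).subset fun a ha => ha.1
      obtain ⟨m, hm, h⟩ : ∃ m < l, ∀ a ∈ {a ∈ Set.range w | a < l}, a ≤ m := by
        rcases Set.eq_empty_or_nonempty {a ∈ Set.range w | a < l} with h | h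
        · exact ⟨l - 1, by linarith, fun a ha => absurd ha (h ▸ Set.notMem_empty a)⟩
        · obtain ⟨m, hm, h⟩ := Set.exists_max_image _ id hfin h
          exact ⟨m, hm.2, h⟩
      refine ⟨(m + l) / 2, by linarith, fun i hi => ?_⟩
      have := h (w i) ⟨⟨i, rfl⟩, hi⟩
      linarith
    refine ⟨l', hl', ?_⟩
    have : {i | l' ≤ w i} = {i | l ≤ w i} := Set.ext fun i =>
      ⟨fun hi => by by_contra h'; exact (h i (not_le.1 h')).not_ge hi, fun hi => hl'.le.trans hi⟩
    simp [weightFil, this]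

theorem mem_weightFil {ι : Type} {b : Basis ι K M} {w : ι → ℝ} {l : ℝ} {m : M} :
    m ∈ weightFil b w l ↔ ∀ i, b.repr m i ≠ 0 → l ≤ w i := by
  rw [weightFil, Basis.mem_span_image]
  simp [Set.subset_def]

theorem basis_mem_weightFil {ι : Type} (b : Basis ι K M) (w : ι → ℝ) (i : ι) :
    b i ∈ weightFil b w (w i) :=
  subset_span (Set.mem_image_of_mem _ (Set.mem_ofPred.2 le_rfl))

theorem finrank_weightFil {ι : Type} [Finite ι] (b : Basis ι K M) (w : ι → ℝ) (l : ℝ) :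
    finrank K (weightFil b w l) = Nat.card {i // l ≤ w i} := by
  have := Fintype.ofFinite ι
  have h := finrank_span_eq_card (R := K) (b := fun i : {i // l ≤ w i} => b i)
    (b.linearIndependent.comp _ Subtype.val_injective)
  rw [Nat.card_eq_fintype_card, ← h, weightFil, Set.image_eq_range]
  rfl

theorem grDim_weightFil {ι : Type} [Fintype ι] (b : Basis ι K M) (w : ι → ℝ) (l : ℝ) :
    grDim K (weightFil b w) l = Finset.card {i | w i = l} := by
  classical
  have : FiniteDimensional K M := b.finiteDimensional_of_finite
  have hsup : (⨆ l', ⨆ (_ : l < l'), weightFil b w l') = span K (b '' {i | l < w i}) := by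
    simp only [weightFil, ← span_iUnion, ← Set.image_iUnion]
    congr 2
    ext i
    simp only [Set.mem_iUnion, Set.mem_ofPred_eq, exists_prop]
    exact ⟨fun ⟨a, h, h'⟩ => h.trans_le h', fun h => ⟨_, h, le_rfl⟩⟩
  have hle : span K (b '' {i | l < w i}) ≤ weightFil b w l :=
    span_mono (Set.image_mono fun i (hi : l < w i) => hi.le)
  have hr : finrank K (span K (b '' {i | l < w i})) = Finset.card {i | l < w i} := by
    have h := finrank_span_eq_card (R := K) (b := fun i : {i // l < w i} => b i)
      (b.linearIndependent.comp _ Subtype.val_injective)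
    rw [← Fintype.card_subtype, ← h, Set.image_eq_range]
    rfl
  have hq := Submodule.finrank_quotient_add_finrank
    (comap (weightFil b w l).subtype (span K (b '' {i | l < w i})))
  rw [(comapSubtypeEquivOfLe hle).finrank_eq, hr, finrank_weightFil, Nat.card_eq_fintype_card,
    Fintype.card_subtype] at hq
  rw [grDim, hsup]
  have hcard : Finset.card {i | l ≤ w i} =
      Finset.card {i | w i = l} + Finset.card {i | l < w i} := by
    rw [← Finset.card_union_of_disjoint]
    · congr 1
      ext i
      simp [le_iff_lt_or_eq, or_comm, eq_comm]
    · rw [Finset.disjoint_left]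
      intro i hi hi'
      simp only [Finset.mem_filter, Finset.mem_univ, true_and] at hi hi'
      linarith
  omega

theorem filDeg_weightFil {ι : Type} [Fintype ι] (b : Basis ι K M) (w : ι → ℝ) :
    filDeg (weightFil b w) = ∑ i, w i := by
  classical
  simp only [filDeg, grDim_weightFil]
  rw [finsum_eq_sum_of_support_subset (s := Finset.univ.image w)]
  · have := Finset.sum_comp (s := Finset.univ) (fun x : ℝ => x) w
    rw [this]
    exact Finset.sum_congr rfl fun t _ => by rw [nsmul_eq_mul, mul_comm]
  · intro t ht
    rw [Function.mem_support] at ht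
    by_contra h
    refine ht ?_
    rw [Finset.card_eq_zero.2, Nat.cast_zero, mul_zero]
    ext i
    simp only [Finset.coe_image, Finset.coe_univ, Set.image_univ, Set.mem_range, not_exists] at h
    simpa using h i

/-- One step of the construction of a basis adapted to a filtration. -/
theorem weightFil_mkFinCons {d : ℕ} {F : ℝ → Submodule K M} (hF : IsFil F) {H : Submodule K M}
    (e : M) (b : Basis (Fin d) K H) (hli) (hsp) (x : Fin d → ℝ)
    (hx : inducedFil F H = weightFil b x) (l : ℝ) (hel : e ∈ F l) (hl : ∀ l', l < l' → F l' ≤ H) :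
    F = weightFil (Basis.mkFinCons e b hli hsp) (Fin.cons l x : Fin (d + 1) → ℝ) := by
  ext t z
  have hHF : ∀ z, z ∈ F t ⊓ H ↔ z ∈ span K ((fun i => (b i : M)) '' {i | t ≤ x i}) := by
    intro z
    have h1 : F t ⊓ H = map H.subtype (inducedFil F H t) := by
      rw [inducedFil, Submodule.map_comap_subtype, inf_comm]
    rw [h1, hx, weightFil, map_span, Set.image_image]
    rfl
  have himg : (Basis.mkFinCons e b hli hsp) '' {i | t ≤ (Fin.cons l x : Fin (d + 1) → ℝ) i} =
      {z | t ≤ l ∧ z = e} ∪ (fun i => (b i : M)) '' {i | t ≤ x i} := by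
    ext z
    rw [Basis.coe_mkFinCons]
    simp only [Set.mem_image, Set.mem_ofPred_eq, Fin.exists_fin_succ, Fin.cons_zero, Fin.cons_succ,
      Set.mem_union, Function.comp_apply, eq_comm (a := z)]
  rw [weightFil, himg]
  by_cases htl : t ≤ l
  · have het : e ∈ F t := hF.antitone htl hel
    simp only [htl, true_and, Set.ofPred_eq_eq_singleton, span_union, mem_sup, ← hHF]
    constructor
    · intro hz
      obtain ⟨c, hc⟩ := hsp z
      exact ⟨-c • e, smul_mem _ _ (mem_span_singleton_self e), z + c • e,
        ⟨add_mem hz (smul_mem _ _ het), hc⟩, by simp⟩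
    · rintro ⟨y, hy, z, hz, rfl⟩
      obtain ⟨c, rfl⟩ := mem_span_singleton.1 hy
      exact add_mem (smul_mem _ _ het) hz.1
  · simp only [htl, false_and, Set.ofPred_false, Set.empty_union, ← hHF]
    exact ⟨fun hz => ⟨hz, hl t (not_le.1 htl) hz⟩, fun hz => hz.1⟩

end

/-- Two filtrations of a finite-dimensional space have a common adapted basis. -/
theorem exists_common_basis (d : ℕ) : ∀ {M : Type} [AddCommGroup M] [Module K M]
    [FiniteDimensional K M] (_ : finrank K M = d) {F G : ℝ → Submodule K M} (_ : IsFil F)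
    (_ : IsFil G), ∃ (b : Basis (Fin d) K M) (x y : Fin d → ℝ),
      F = weightFil b x ∧ G = weightFil b y := by
  induction d with
  | zero =>
    intro M _ _ _ hM F G _ _
    have := finrank_zero_iff.1 hM
    exact ⟨finBasisOfFinrankEq K M hM, 0, 0, Subsingleton.elim _ _, Subsingleton.elim _ _⟩
  | succ d ih =>
    intro M _ _ _ hM F G hF hG
    have : Nontrivial M := nontrivial_of_finrank_pos (R := K) (by omega)
    obtain ⟨a, ha, hmax⟩ := hF.antitone.exists_forall_le_filtration (S := {l | F l ≠ ⊤})
      (hF.exists_eq_bot.imp fun c hc => by simp [hc])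
    obtain ⟨H, hH, haH⟩ := (eq_top_or_exists_le_coatom (F a)).resolve_left ha
    obtain ⟨l, hl, hl'⟩ := hF.exists_last_not_le hH.1
    have hlt : F l = ⊤ := by
      by_contra h
      exact hl ((hmax l h).trans haH)
    obtain ⟨g, hg, hg'⟩ := hG.exists_last_not_le hH.1
    obtain ⟨e, heg, heH⟩ := SetLike.not_le_iff_exists.1 hg
    have hsup : H ⊔ span K {e} = ⊤ := hH.2 _ (by
      refine lt_of_le_of_ne le_sup_left fun h => heH ?_
      rw [h]
      exact mem_sup_right (mem_span_singleton_self e))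
    have hsp : ∀ z, ∃ c : K, z + c • e ∈ H := by
      intro z
      have hz : z ∈ H ⊔ span K {e} := hsup ▸ mem_top
      obtain ⟨y, hy, z', hz', rfl⟩ := mem_sup.1 hz
      obtain ⟨c, rfl⟩ := mem_span_singleton.1 hz'
      exact ⟨-c, by simpa using hy⟩
    have hli : ∀ c : K, ∀ x ∈ H, c • e + x = 0 → c = 0 := by
      intro c x hx h
      by_contra hc
      refine heH ((smul_mem_iff H hc).1 ?_)
      rw [eq_neg_of_add_eq_zero_left h]
      exact neg_mem hx
    have hHd : finrank K H = d := by
      have h2 := finrank_eq_card_basis (Basis.mkFinCons e (finBasis K H) hli hsp)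
      rw [hM, Fintype.card_fin] at h2
      omega
    obtain ⟨b, x, y, hx, hy⟩ := ih hHd (hF.induced H) (hG.induced H)
    exact ⟨Basis.mkFinCons e b hli hsp, Fin.cons l x, Fin.cons g y,
      weightFil_mkFinCons hF e b hli hsp x hx l (hlt ▸ mem_top) hl',
      weightFil_mkFinCons hG e b hli hsp y hy g heg hg'⟩

section

variable {M : Type} [AddCommGroup M] [Module K M]

theorem IsFil.exists_adapted_basis [FiniteDimensional K M] {F : ℝ → Submodule K M}
    (hF : IsFil F) :
    ∃ (b : Basis (Fin (finrank K M)) K M) (x : Fin (finrank K M) → ℝ), F = weightFil b x := by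
  obtain ⟨b, x, -, hx, -⟩ := exists_common_basis _ rfl hF hF
  exact ⟨b, x, hx⟩

theorem IsFil.sum_le_filDeg {F : ℝ → Submodule K M} (hF : IsFil F) {κ : Type} [Fintype κ]
    (u : Basis κ K M) (ω : κ → ℝ) (hu : ∀ r, u r ∈ F (ω r)) : ∑ r, ω r ≤ filDeg F := by
  have : FiniteDimensional K M := u.finiteDimensional_of_finite
  obtain ⟨b, x, rfl⟩ := hF.exists_adapted_basis
  rw [filDeg_weightFil]
  refine sum_le_sum_of_card_superlevel _ _ ?_ fun t => ?_
  · rw [Fintype.card_fin, finrank_eq_card_basis u]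
  · rw [← finrank_weightFil u, ← finrank_weightFil b]
    refine Submodule.finrank_mono (span_le.2 ?_)
    rintro _ ⟨r, hr, rfl⟩
    exact hF.antitone hr (hu r)

theorem IsFil.filDeg_le [FiniteDimensional K M] {F : ℝ → Submodule K M} (hF : IsFil F) {C : ℝ}
    (hC : ∀ l, C < l → F l = ⊥) : filDeg F ≤ finrank K M * C := by
  obtain ⟨b, x, rfl⟩ := hF.exists_adapted_basis
  rw [filDeg_weightFil]
  calc ∑ i, x i ≤ ∑ _i : Fin (finrank K M), C := Finset.sum_le_sum fun i _ => by
        by_contra! h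
        have h1 := basis_mem_weightFil b x i
        rw [hC _ h, mem_bot] at h1
        exact b.ne_zero i h1
    _ = finrank K M * C := by simp

theorem IsFil.le_filDeg [FiniteDimensional K M] {F : ℝ → Submodule K M} (hF : IsFil F) {c : ℝ}
    (hc : F c = ⊤) : finrank K M * c ≤ filDeg F := by
  have := hF.sum_le_filDeg (finBasis K M) (fun _ => c) fun r => hc ▸ mem_top
  simpa using this

theorem IsFil.filDeg_congr [FiniteDimensional K M] {F G : ℝ → Submodule K M} (hF : IsFil F)
    (hG : IsFil G) (h : ∀ t, finrank K (F t) = finrank K (G t)) : filDeg F = filDeg G := by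
  obtain ⟨b, x, rfl⟩ := hF.exists_adapted_basis
  obtain ⟨b', x', rfl⟩ := hG.exists_adapted_basis
  simp only [finrank_weightFil] at h
  rw [filDeg_weightFil, filDeg_weightFil]
  exact sum_comp_eq_of_card_superlevel x x' h id

variable {ι : Type} [Finite ι] (b : Basis ι K M) (V : Submodule K M)

theorem filDeg_induced_weightFil_le (w : ι → ℝ) {C : ℝ} (hC : ∀ i, w i ≤ C) :
    filDeg (inducedFil (weightFil b w) V) ≤ finrank K V * C := by
  have : FiniteDimensional K M := b.finiteDimensional_of_finite
  refine ((weightFil_isFil b w).induced V).filDeg_le fun l hl => ?_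
  rw [eq_bot_iff]
  intro z hz
  have hz' : (z : M) ∈ weightFil b w l := hz
  have h0 : b.repr (z : M) = 0 := by
    ext i
    by_contra h
    exact ((mem_weightFil.1 hz' i h).trans (hC i)).not_gt hl
  simpa using h0

theorem le_filDeg_induced_weightFil (w : ι → ℝ) {c : ℝ} (hc : ∀ i, c ≤ w i) :
    finrank K V * c ≤ filDeg (inducedFil (weightFil b w) V) := by
  have : FiniteDimensional K M := b.finiteDimensional_of_finite
  refine ((weightFil_isFil b w).induced V).le_filDeg ?_
  rw [eq_top_iff]
  intro z _
  exact mem_weightFil.2 fun i _ => hc i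

/-- The degree of a subspace is superadditive in the weights on a fixed basis. -/
theorem filDeg_induced_add_le (w w' : ι → ℝ) :
    filDeg (inducedFil (weightFil b w) V) + filDeg (inducedFil (weightFil b w') V) ≤
      filDeg (inducedFil (weightFil b (w + w')) V) := by
  have : FiniteDimensional K M := b.finiteDimensional_of_finite
  obtain ⟨u, x, y, hx, hy⟩ := exists_common_basis _ rfl ((weightFil_isFil b w).induced V)
    ((weightFil_isFil b w').induced V)
  have hsum := ((weightFil_isFil b (w + w')).induced V).sum_le_filDeg u (x + y) fun r => by
    have h1 := hx ▸ basis_mem_weightFil u x r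
    have h2 := hy ▸ basis_mem_weightFil u y r
    exact mem_weightFil.2 fun i hi =>
      add_le_add (mem_weightFil.1 (mem_comap.1 h1) i hi) (mem_weightFil.1 (mem_comap.1 h2) i hi)
  rw [hx, hy, filDeg_weightFil, filDeg_weightFil, ← Finset.sum_add_distrib]
  exact hsum

theorem filDeg_induced_smul (w : ι → ℝ) {t : ℝ} (ht : 0 < t) :
    filDeg (inducedFil (weightFil b (t • w)) V) = t * filDeg (inducedFil (weightFil b w) V) := by
  have : FiniteDimensional K M := b.finiteDimensional_of_finite
  have hscale : ∀ {κ N : Type} [AddCommGroup N] [Module K N] (c : Basis κ K N) (x : κ → ℝ) (l : ℝ),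
      weightFil c (t • x) l = weightFil c x (l / t) := by
    intro κ N _ _ c x l
    simp only [weightFil, Pi.smul_apply, smul_eq_mul, div_le_iff₀' ht]
  obtain ⟨u, x, hx⟩ := ((weightFil_isFil b w).induced V).exists_adapted_basis
  have : inducedFil (weightFil b (t • w)) V = weightFil u (t • x) := by
    ext1 l
    rw [hscale u, ← hx, inducedFil, hscale b, inducedFil]
  rw [this, hx, filDeg_weightFil, filDeg_weightFil, Finset.mul_sum]
  rfl

theorem continuous_filDeg_induced [Fintype ι] :
    Continuous fun w : ι → ℝ => filDeg (inducedFil (weightFil b w) V) := by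
  have key : ∀ w w' : ι → ℝ, filDeg (inducedFil (weightFil b w) V) ≤
      filDeg (inducedFil (weightFil b w') V) + finrank K V * dist w w' := by
    intro w w'
    have h1 := filDeg_induced_add_le b V w (w' - w)
    have h2 := le_filDeg_induced_weightFil b V (w' - w) (c := -dist w w') fun i => by
      have := dist_le_pi_dist w w' i
      rw [Real.dist_eq] at this
      have := (abs_le.1 this).2
      simp only [Pi.sub_apply]
      linarith
    rw [add_sub_cancel] at h1
    linarith
  refine (LipschitzWith.of_le_add_mul (finrank K V : NNReal) fun w w' => ?_).continuous
  simpa using key w w'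

end

/-- The concave functional whose maximum plays the role of Kempf's optimal destabilising flag. -/
noncomputable def kempfFun {k : ℕ} {m : Fin k → ℕ} {W : Type} [AddCommGroup W] [Module K W]
    (V : Submodule K W) (b : Basis (∀ i, Fin (m i)) K W) (x : ∀ i, Fin (m i) → ℝ) : ℝ :=
  filDeg (inducedFil (weightFil b fun p => ∑ i, x i (p i)) V) - (∑ i, ∑ j, x i j ^ 2) / 2

theorem exists_max_kempfFun {k : ℕ} {m : Fin k → ℕ} {W : Type} [AddCommGroup W] [Module K W]
    (V : Submodule K W) {β : Type} [Nonempty β] (B : β → Basis (∀ i, Fin (m i)) K W) :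
    ∃ e x, ∀ e' x', kempfFun V (B e') x' ≤ kempfFun V (B e) x := by
  classical
  obtain ⟨e₀⟩ := id ‹Nonempty β›
  have : FiniteDimensional K W := (B e₀).finiteDimensional_of_finite
  have hmax : ∀ e, ∃ x, ∀ x', kempfFun V (B e) x' ≤ kempfFun V (B e) x := by
    intro e
    have hcont : Continuous (kempfFun V (B e)) := by
      refine Continuous.sub ((continuous_filDeg_induced (B e) V).comp ?_) ?_ <;> fun_prop
    set R : ℝ := 2 * (finrank K V * k) with hR
    have hR0 : 0 ≤ R := by positivity
    obtain ⟨x, -, hx⟩ := (isCompact_closedBall (0 : ∀ i, Fin (m i) → ℝ) R).exists_isMaxOn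
      ⟨0, by simpa using hR0⟩ hcont.continuousOn
    refine ⟨x, fun x' => ?_⟩
    by_cases hx' : x' ∈ Metric.closedBall 0 R
    · exact hx hx'
    have h0 : kempfFun V (B e) 0 ≤ kempfFun V (B e) x := hx (by simpa using hR0)
    have h00 : 0 ≤ kempfFun V (B e) 0 := by
      have := le_filDeg_induced_weightFil (B e) V (fun _ => 0) (c := 0) fun _ => le_rfl
      simpa [kempfFun] using this
    refine le_trans ?_ (h00.trans h0)
    set s := √(∑ i, ∑ j, x' i j ^ 2) with hs
    have hs0 : 0 ≤ s := Real.sqrt_nonneg _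
    have hsq : s ^ 2 = ∑ i, ∑ j, x' i j ^ 2 := Real.sq_sqrt (by positivity)
    have hle : ∀ i j, |x' i j| ≤ s := fun i j => Real.abs_le_sqrt
      ((Finset.single_le_sum (f := fun j => x' i j ^ 2) (fun _ _ => sq_nonneg _)
        (Finset.mem_univ j)).trans
      (Finset.single_le_sum (f := fun i => ∑ j, x' i j ^ 2)
        (fun _ _ => Finset.sum_nonneg fun _ _ => sq_nonneg _) (Finset.mem_univ i)))
    have hRs : R < s := by
      by_contra! h
      refine hx' ?_
      rw [mem_closedBall_zero_iff]
      exact ((pi_norm_le_iff_of_nonneg hs0).2 fun i =>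
        (pi_norm_le_iff_of_nonneg hs0).2 fun j => hle i j).trans h
    have hD := filDeg_induced_weightFil_le (B e) V (fun p => ∑ i, x' i (p i)) (C := k * s)
      fun p => by
        calc ∑ i, x' i (p i) ≤ ∑ _i : Fin k, s :=
              Finset.sum_le_sum fun i _ => (le_abs_self _).trans (hle i _)
          _ = k * s := by simp
    rw [kempfFun, ← hsq]
    nlinarith
  choose x hx using hmax
  let ρ : β → Set (∀ i, Fin (m i)) → Fin (finrank K V + 1) := fun e S =>
    ⟨finrank K (comap V.subtype (span K (B e '' S))), Nat.lt_succ_of_le (finrank_le _)⟩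
  have hρ : ∀ e e', ρ e = ρ e' → ∀ y, kempfFun V (B e) y = kempfFun V (B e') y := by
    intro e e' h y
    rw [kempfFun, kempfFun]
    congr 1
    exact ((weightFil_isFil _ _).induced V).filDeg_congr ((weightFil_isFil _ _).induced V)
      fun t => congr_arg Fin.val (congr_fun h {p | t ≤ ∑ i, y i (p i)})
  have : Nonempty (Set.range ρ) := ⟨⟨_, e₀, rfl⟩⟩
  obtain ⟨r, hr⟩ := Finite.exists_max fun r : Set.range ρ =>
    kempfFun V (B r.2.choose) (x r.2.choose)
  refine ⟨r.2.choose, x r.2.choose, fun e' x' => ?_⟩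
  have hspec := (⟨ρ e', e', rfl⟩ : Set.range ρ).2.choose_spec
  rw [← hρ _ _ hspec]
  exact (hx _ _).trans (hr ⟨ρ e', e', rfl⟩)

theorem filDeg_le_of_forall_kempfFun_le {k : ℕ} {m : Fin k → ℕ} {W : Type} [AddCommGroup W]
    [Module K W] (V : Submodule K W) (b : Basis (∀ i, Fin (m i)) K W) (y : ∀ i, Fin (m i) → ℝ)
    (hy : ∀ x, kempfFun V b x ≤ kempfFun V b y) (x : ∀ i, Fin (m i) → ℝ) :
    filDeg (inducedFil (weightFil b fun p => ∑ i, x i (p i)) V) ≤ ∑ i, ∑ j, x i j * y i j := by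
  set D := filDeg (inducedFil (weightFil b fun p => ∑ i, x i (p i)) V) with hD
  set S := ∑ i, ∑ j, x i j * y i j with hS
  set Q := ∑ i, ∑ j, x i j ^ 2 with hQ
  have hQ0 : 0 ≤ Q := Finset.sum_nonneg fun _ _ => Finset.sum_nonneg fun _ _ => sq_nonneg _
  have key : ∀ t > 0, D ≤ S + t * Q / 2 := by
    intro t ht
    have h1 := hy (y + t • x)
    have h2 := filDeg_induced_add_le b V (fun p => ∑ i, y i (p i))
      (t • fun p => ∑ i, x i (p i))
    rw [filDeg_induced_smul b V _ ht, ← hD] at h2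
    have h3 : (fun p : ∀ i, Fin (m i) => ∑ i, (y + t • x) i (p i)) =
        (fun p => ∑ i, y i (p i)) + (t • fun p => ∑ i, x i (p i)) := by
      ext p
      simp [Finset.sum_add_distrib, Finset.mul_sum]
    have h4 : ∑ i, ∑ j, (y + t • x) i j ^ 2 = ∑ i, ∑ j, y i j ^ 2 + 2 * t * S + t ^ 2 * Q := by
      simp only [hS, hQ, Finset.mul_sum, ← Finset.sum_add_distrib]
      refine Finset.sum_congr rfl fun i _ => Finset.sum_congr rfl fun j _ => ?_
      simp only [Pi.add_apply, Pi.smul_apply, smul_eq_mul]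
      ring
    rw [kempfFun, kempfFun, h3, h4] at h1
    refine le_of_mul_le_mul_left ?_ ht
    linarith
  refine le_of_forall_pos_le_add fun ε hε => ?_
  have h := key (ε / (Q + 1)) (by positivity)
  have h' : ε / (Q + 1) * Q ≤ ε := by
    rw [div_mul_eq_mul_div, div_le_iff₀ (by positivity)]
    nlinarith
  linarith

section Tensor

variable {k : ℕ} {M : Fin k → Type} [∀ i, AddCommGroup (M i)] [∀ i, Module K (M i)]

/-- The tensor product of filtrations. -/
def tensorFil (F : ∀ i, ℝ → Submodule K (M i)) (lam : ℝ) : Submodule K (⨂[K] i, M i) :=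
  span K { t : ⨂[K] i, M i | ∃ c : Fin k → ℝ,
    lam ≤ ∑ i, c i ∧ ∃ m : ∀ i, M i, (∀ i, m i ∈ F i (c i)) ∧ t = PiTensorProduct.tprod K m }

theorem tensorFil_weightFil {κ : Fin k → Type} (b : ∀ i, Basis (κ i) K (M i))
    (w : ∀ i, κ i → ℝ) :
    tensorFil (fun i => weightFil (b i) (w i)) =
      weightFil (Basis.piTensorProduct b) fun p => ∑ i, w i (p i) := by
  ext1 l
  refine le_antisymm (span_le.2 ?_) (span_le.2 ?_)
  · rintro _ ⟨c, hc, m, hm, rfl⟩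
    refine mem_weightFil.2 fun p hp => hc.trans (Finset.sum_le_sum fun i _ => ?_)
    rw [Basis.piTensorProduct_repr_tprod_apply, Finset.prod_ne_zero_iff] at hp
    exact mem_weightFil.1 (hm i) _ (hp i (Finset.mem_univ i))
  · rintro _ ⟨p, hp, rfl⟩
    exact subset_span ⟨fun i => w i (p i), hp, fun i => b i (p i),
      fun i => basis_mem_weightFil _ _ _, Basis.piTensorProduct_apply _ _⟩

variable [∀ i, FiniteDimensional K (M i)]

theorem tensorFil_isFil {F : ∀ i, ℝ → Submodule K (M i)} (hF : ∀ i, IsFil (F i)) :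
    IsFil (tensorFil F) := by
  choose b x hb using fun i => (hF i).exists_adapted_basis
  obtain rfl : F = fun i => weightFil (b i) (x i) := funext hb
  rw [tensorFil_weightFil]
  exact weightFil_isFil _ _

/-- Every subspace `V` of a tensor product admits filtrations of the factors, given by `b` and `y`,
whose pairing with arbitrary filtrations bounds the degree of `V`. -/
theorem exists_dominating_filtrations (V : Submodule K (⨂[K] i, M i)) :
    ∃ (b : ∀ i, Basis (Fin (finrank K (M i))) K (M i)) (y : ∀ i, Fin (finrank K (M i)) → ℝ),
      (∀ i j, 0 ≤ y i j) ∧ (∀ i, ∑ j, y i j = finrank K V) ∧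
      ∀ F : ∀ i, ℝ → Submodule K (M i), (∀ i, IsFil (F i)) →
        ∃ (b' : ∀ i, Basis (Fin (finrank K (M i))) K (M i))
          (x' y' : ∀ i, Fin (finrank K (M i)) → ℝ), (∀ i, F i = weightFil (b' i) (x' i)) ∧
          (∀ i, weightFil (b i) (y i) = weightFil (b' i) (y' i)) ∧
          filDeg (inducedFil (tensorFil F) V) ≤ ∑ i, ∑ j, x' i j * y' i j := by
  classical
  have : Nonempty (∀ i, Basis (Fin (finrank K (M i))) K (M i)) := ⟨fun i => finBasis K (M i)⟩
  obtain ⟨b, y, hmax⟩ := exists_max_kempfFun V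
    fun b : ∀ i, Basis (Fin (finrank K (M i))) K (M i) => Basis.piTensorProduct b
  have hderiv := filDeg_le_of_forall_kempfFun_le V _ y (hmax b)
  refine ⟨b, y, fun i j => ?_, fun i => le_antisymm ?_ ?_, fun F hF => ?_⟩
  · have h1 := hderiv (Pi.single i (Pi.single j 1))
    have h2 := le_filDeg_induced_weightFil (Basis.piTensorProduct b) V (fun p =>
      ∑ i', (Pi.single i (Pi.single j 1) : ∀ i, Fin (finrank K (M i)) → ℝ) i' (p i')) (c := 0)
      fun p => Finset.sum_nonneg fun i' _ =>
        (Pi.single_nonneg.2 (Pi.single_nonneg.2 zero_le_one) :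
          (0 : ∀ i, Fin (finrank K (M i)) → ℝ) ≤ _) i' (p i')
    have h3 : ∑ i', ∑ j', (Pi.single i (Pi.single j 1) :
        ∀ i, Fin (finrank K (M i)) → ℝ) i' j' * y i' j' = y i j := by
      rw [Finset.sum_eq_single i]
      · simp [Pi.single_apply]
      · intro i' _ hi
        simp [Pi.single_eq_of_ne hi]
      · simp
    linarith
  · have h1 := hderiv (Pi.single i (-1))
    have h2 := le_filDeg_induced_weightFil (Basis.piTensorProduct b) V (fun p =>
      ∑ i', (Pi.single i (-1) : ∀ i, Fin (finrank K (M i)) → ℝ) i' (p i')) (c := -1)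
      fun p => by
        rw [Finset.sum_eq_single i]
        · simp
        · intro i' _ hi
          simp [Pi.single_eq_of_ne hi]
        · simp
    have h3 : ∑ i', ∑ j', (Pi.single i (-1) :
        ∀ i, Fin (finrank K (M i)) → ℝ) i' j' * y i' j' = -∑ j, y i j := by
      rw [Finset.sum_eq_single i]
      · simp
      · intro i' _ hi
        simp [Pi.single_eq_of_ne hi]
      · simp
    linarith
  · have h1 := hderiv (Pi.single i 1)
    have h2 := le_filDeg_induced_weightFil (Basis.piTensorProduct b) V (fun p =>
      ∑ i', (Pi.single i 1 : ∀ i, Fin (finrank K (M i)) → ℝ) i' (p i')) (c := 1)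
      fun p => by
        rw [Finset.sum_eq_single i]
        · simp
        · intro i' _ hi
          simp [Pi.single_eq_of_ne hi]
        · simp
    have h3 : ∑ i', ∑ j', (Pi.single i 1 :
        ∀ i, Fin (finrank K (M i)) → ℝ) i' j' * y i' j' = ∑ j, y i j := by
      rw [Finset.sum_eq_single i]
      · simp
      · intro i' _ hi
        simp [Pi.single_eq_of_ne hi]
      · simp
    linarith
  · choose b' x' y' hx hy using fun i =>
      exists_common_basis _ rfl (hF i) (weightFil_isFil (b i) (y i))
    refine ⟨b', x', y', hx, hy, ?_⟩
    obtain rfl : F = fun i => weightFil (b' i) (x' i) := funext hx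
    have heq : kempfFun V (Basis.piTensorProduct b) y =
        kempfFun V (Basis.piTensorProduct b') y' := by
      rw [kempfFun, kempfFun, ← tensorFil_weightFil, ← tensorFil_weightFil, funext hy]
      congr 2
      refine Finset.sum_congr rfl fun i _ =>
        sum_comp_eq_of_card_superlevel (y i) (y' i) (fun t => ?_) (· ^ 2)
      rw [← finrank_weightFil (b i), ← finrank_weightFil (b' i), hy]
    rw [tensorFil_weightFil]
    exact filDeg_le_of_forall_kempfFun_le V _ y' (fun x => heq ▸ hmax b' x) x'

end Tensor

section

variable {M : Type} [AddCommGroup M] [Module K M]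

theorem exists_basis_weightFil {ι : Type} (b : Basis ι K M) (y : ι → ℝ) (t : ℝ) :
    ∃ u : Basis {j // t ≤ y j} K (weightFil b y t), ∀ r, (u r : M) = b r := by
  have hli : LinearIndependent K fun j : {j // t ≤ y j} => b j :=
    b.linearIndependent.comp _ Subtype.val_injective
  have h : span K (Set.range fun j : {j // t ≤ y j} => b j) = weightFil b y t := by
    rw [weightFil, Set.image_eq_range]
    rfl
  exact ⟨(Basis.span hli).map (LinearEquiv.ofEq _ _ h), fun r => by simp [Basis.span_apply]⟩

/-- Pairing filtrations of total slope at most `a` with a nonnegative filtration. -/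
theorem sum_pairing_le {n : ℕ} {ι : Type} [Fintype ι] {F : Fin n → ℝ → Submodule K M}
    (hF : ∀ v, IsFil (F v)) {a : ℝ}
    (ha : ∀ N : Submodule K M, ∑ v, filDeg (inducedFil (F v) N) ≤ a * finrank K N)
    (b : Basis ι K M) (y : ι → ℝ) (hy : ∀ j, 0 ≤ y j) (b' : Fin n → Basis ι K M)
    (x' y' : Fin n → ι → ℝ) (hx' : ∀ v, F v = weightFil (b' v) (x' v))
    (hy' : ∀ v, weightFil b y = weightFil (b' v) (y' v)) :
    ∑ v, ∑ j, x' v j * y' v j ≤ a * ∑ j, y j := by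
  classical
  have hy'0 : ∀ v j, 0 ≤ y' v j := by
    intro v j
    have h : b' v j ∈ weightFil b y 0 := mem_weightFil.2 fun i _ => hy i
    rw [hy' v] at h
    exact mem_weightFil.1 h j (by simp)
  have hpart : ∀ t v, (∑ j, if t ≤ y' v j then x' v j else 0) ≤
      filDeg (inducedFil (F v) (weightFil b y t)) := by
    intro t v
    rw [hy' v]
    obtain ⟨u, hu⟩ := exists_basis_weightFil (b' v) (y' v) t
    have := ((hF v).induced (weightFil (b' v) (y' v) t)).sum_le_filDeg u (fun r => x' v r)
      fun r => by
        rw [inducedFil, mem_comap, coe_subtype, hu, hx' v]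
        exact basis_mem_weightFil _ _ _
    rwa [← Finset.sum_filter, ← Finset.sum_subtype_eq_sum_filter, Finset.subtype_univ]
  have key := sum_mul_nonneg_of_superlevel (J := (Fin n × ι) ⊕ ι)
    (Sum.elim (fun p => -x' p.1 p.2) fun _ => a) (Sum.elim (fun p => y' p.1 p.2) y)
    (by rintro (p | j); exacts [hy'0 _ _, hy _]) (by
      intro t
      have hN := ha (weightFil b y t)
      rw [finrank_weightFil, Nat.card_eq_fintype_card, Fintype.card_subtype,
        Finset.natCast_card_filter, Finset.mul_sum] at hN
      have hs := Finset.sum_le_sum fun v (_ : v ∈ Finset.univ) => hpart t v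
      have e : ∀ v j, (if t ≤ y' v j then -x' v j else 0) =
          -(if t ≤ y' v j then x' v j else 0) := by
        intro v j; split_ifs <;> simp
      rw [Fintype.sum_sum_type, Fintype.sum_prod_type]
      change 0 ≤ (∑ v, ∑ j, if t ≤ y' v j then -x' v j else 0) + ∑ j, if t ≤ y j then a else 0
      simp only [e, Finset.sum_neg_distrib]
      simp only [mul_ite, mul_one, mul_zero] at hN
      linarith)
  simp only [Fintype.sum_sum_type, Sum.elim_inl, Sum.elim_inr, Fintype.sum_prod_type, neg_mul,
    Finset.sum_neg_distrib, ← Finset.mul_sum] at key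
  linarith

theorem bddAbove_slopes [FiniteDimensional K M] {n : ℕ} {F : Fin n → ℝ → Submodule K M}
    (hF : ∀ v, IsFil (F v)) :
    BddAbove { x : ℝ | ∃ N : Submodule K M, N ≠ ⊥ ∧
      x = mfMu K ↥N (fun v l => (F v l).comap N.subtype) } := by
  choose C hC using fun v => (hF v).exists_eq_bot
  refine ⟨∑ v, C v, ?_⟩
  rintro _ ⟨N, hN, rfl⟩
  have hpos : (0 : ℝ) < finrank K N :=
    Nat.cast_pos.2 (Nat.pos_of_ne_zero fun h => hN (finrank_eq_zero.1 h))
  rw [mfMu, div_le_iff₀ hpos, Finset.sum_mul]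
  refine Finset.sum_le_sum fun v _ => ?_
  rw [mul_comm]
  refine ((hF v).induced N).filDeg_le fun l hl => ?_
  have : F v l = ⊥ := bot_unique (hC v ▸ (hF v).antitone hl.le)
  simp [inducedFil, this]

theorem sum_filDeg_le_mfMuMax [FiniteDimensional K M] {n : ℕ} {F : Fin n → ℝ → Submodule K M}
    (hF : ∀ v, IsFil (F v)) (N : Submodule K M) :
    ∑ v, filDeg (inducedFil (F v) N) ≤ mfMuMax K M F * finrank K N := by
  by_cases hN : N = ⊥
  · subst hN
    have h0 : finrank K (⊥ : Submodule K M) = 0 := finrank_bot K M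
    rw [h0, Nat.cast_zero, mul_zero]
    refine Finset.sum_nonpos fun v _ => ?_
    have := ((hF v).induced ⊥).filDeg_le (C := 0) fun l _ => Subsingleton.elim _ _
    simpa using this
  · have hpos : (0 : ℝ) < finrank K N :=
      Nat.cast_pos.2 (Nat.pos_of_ne_zero fun h => hN (finrank_eq_zero.1 h))
    rw [← div_le_iff₀ hpos]
    exact le_csSup (bddAbove_slopes hF) ⟨N, hN, rfl⟩

end

section Slopes

variable {k n : ℕ} {M : Fin k → Type} [∀ i, AddCommGroup (M i)] [∀ i, Module K (M i)]
  [∀ i, FiniteDimensional K (M i)] {F : ∀ i, Fin n → ℝ → Submodule K (M i)}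

theorem slope_le_sum_mfMuMax (hF : ∀ i v, IsFil (F i v)) {V : Submodule K (⨂[K] i, M i)}
    (hV : V ≠ ⊥) :
    mfMu K V (fun v => inducedFil (tensorFil fun i => F i v) V) ≤ ∑ i, mfMuMax K (M i) (F i) := by
  obtain ⟨b, y, hy0, hy, h⟩ := exists_dominating_filtrations V
  choose b' x' y' hx' hy' hle using fun v => h (fun i => F i v) fun i => hF i v
  have hpos : (0 : ℝ) < finrank K V :=
    Nat.cast_pos.2 (Nat.pos_of_ne_zero fun h => hV (finrank_eq_zero.1 h))
  rw [mfMu, div_le_iff₀ hpos, Finset.sum_mul]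
  refine (Finset.sum_le_sum fun v _ => hle v).trans ?_
  rw [Finset.sum_comm]
  refine Finset.sum_le_sum fun i _ => ?_
  rw [← hy i]
  exact sum_pairing_le (hF i) (sum_filDeg_le_mfMuMax (hF i)) (b i) (y i) (hy0 i)
    (fun v => b' v i) (fun v => x' v i) (fun v => y' v i) (fun v => hx' v i) fun v => hy' v i

theorem exists_sum_slopes_le (hF : ∀ i v, IsFil (F i v)) (N : ∀ i, Submodule K (M i))
    (hN : ∀ i, N i ≠ ⊥) :
    ∃ V : Submodule K (⨂[K] i, M i), V ≠ ⊥ ∧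
      ∑ i, mfMu K (N i) (fun v => inducedFil (F i v) (N i)) ≤
        mfMu K V (fun v => inducedFil (tensorFil fun i => F i v) V) := by
  classical
  have hinj : Function.Injective (PiTensorProduct.map fun i => (N i).subtype) := by
    choose g hg using fun i => (N i).subtype.exists_leftInverse_of_injective (N i).ker_subtype
    have h : PiTensorProduct.map g ∘ₗ PiTensorProduct.map (fun i => (N i).subtype) =
        LinearMap.id := by
      rw [← PiTensorProduct.map_comp, funext hg, PiTensorProduct.map_id]
    exact Function.LeftInverse.injective fun z => LinearMap.congr_fun h z
  have hpos : ∀ i, 0 < finrank K (N i) := fun i =>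
    Nat.pos_of_ne_zero fun h => hN i (finrank_eq_zero.1 h)
  set V := LinearMap.range (PiTensorProduct.map fun i => (N i).subtype) with hVdef
  have hVrank : finrank K V = ∏ i, finrank K (N i) := by
    rw [hVdef, LinearMap.finrank_range_of_inj hinj,
      finrank_eq_card_basis (Basis.piTensorProduct fun i => finBasis K (N i))]
    simp
  have hVpos : 0 < finrank K V := hVrank ▸ Finset.prod_pos fun i _ => hpos i
  have hVpos' : (0 : ℝ) < finrank K V := Nat.cast_pos.2 hVpos
  refine ⟨V, fun h => ?_, ?_⟩
  · rw [h, finrank_bot] at hVpos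
    exact hVpos.false
  rw [mfMu, le_div_iff₀ hVpos']
  simp only [mfMu]
  rw [Finset.sum_mul]
  simp only [Finset.sum_div, Finset.sum_mul]
  rw [Finset.sum_comm]
  refine Finset.sum_le_sum fun v _ => ?_
  choose e w hw using fun i => ((hF i v).induced (N i)).exists_adapted_basis
  have hdeg := ((tensorFil_isFil fun i => hF i v).induced V).sum_le_filDeg
    ((Basis.piTensorProduct e).map (LinearEquiv.ofInjective _ hinj)) (fun p => ∑ i, w i (p i))
    fun p => by
      rw [inducedFil, mem_comap]
      refine subset_span ⟨fun i => w i (p i), le_rfl, fun i => (e i (p i) : M i), fun i => ?_, ?_⟩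
      · exact mem_comap.1 (hw i ▸ basis_mem_weightFil (e i) (w i) (p i))
      · rw [Basis.map_apply, Basis.piTensorProduct_apply]
        exact PiTensorProduct.map_tprod _ _
  refine le_trans (le_of_eq ?_) hdeg
  rw [Finset.sum_comm]
  refine Finset.sum_congr rfl fun i _ => ?_
  change filDeg (inducedFil (F i v) (N i)) / _ * _ = _
  have hsum : ∑ p : ∀ i, Fin (finrank K (N i)), w i (p i) =
      (∏ i' ∈ Finset.univ.erase i, (finrank K (N i') : ℝ)) * ∑ j, w i j := by
    have h := Finset.prod_univ_sum (fun i' => (Finset.univ : Finset (Fin (finrank K (N i')))))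
      (Function.update (fun _ _ => (1 : ℝ)) i (w i))
    rw [Fintype.piFinset_univ, ← Finset.mul_prod_erase _ _ (Finset.mem_univ i), mul_comm] at h
    rw [Finset.prod_congr rfl (g := fun i' => (finrank K (N i') : ℝ)) fun i' hi' => by
      simp [Function.update_of_ne (Finset.ne_of_mem_erase hi')], Function.update_self] at h
    rw [h]
    refine Finset.sum_congr rfl fun p _ => ?_
    rw [← Finset.mul_prod_erase _ _ (Finset.mem_univ i), Function.update_self,
      Finset.prod_eq_one fun i' hi' => by
        rw [Function.update_of_ne (Finset.ne_of_mem_erase hi')], mul_one]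
  have hne : (finrank K (N i) : ℝ) ≠ 0 := Nat.cast_ne_zero.2 (hpos i).ne'
  rw [hsum, hw i, filDeg_weightFil, hVrank, Nat.cast_prod,
    ← Finset.mul_prod_erase _ _ (Finset.mem_univ i)]
  field_simp

end Slopes

end Filtrations

/-- For any finite family `(M̄ i)_{i}` of nonzero multifiltered vector
spaces over a field `K` (each carrying the same number `n` of filtrations), one has
`μ_max(M̄ 1 ⊗ ⋯ ⊗ M̄ k) = ∑ i μ_max(M̄ i)`, where the tensor product carries the
filtrations `F_v^{≥λ}(⊗ᵢ Mᵢ) = ∑_{λ₁+⋯+λ_k ≥ λ} F_v^{≥λ₁}M₁ ⊗ ⋯ ⊗ F_v^{≥λ_k}M_k`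
(the span of the pure tensors of elements `mᵢ ∈ F_v^{≥λᵢ}Mᵢ` with `∑ λᵢ ≥ λ`). -/
theorem mfMuMax_tensor (K : Type) [Field K] (n k : ℕ)
    (M : Fin k → Type) [∀ i, AddCommGroup (M i)] [∀ i, Module K (M i)]
    [∀ i, FiniteDimensional K (M i)] (hM : ∀ i, Nontrivial (M i))
    (F : ∀ i, Fin n → ℝ → Submodule K (M i))
    (hF : ∀ i, IsMultiFiltration K (F i)) :
    mfMuMax K (⨂[K] i, M i)
        (fun v lam => Submodule.span K { t : ⨂[K] i, M i | ∃ c : Fin k → ℝ,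
          lam ≤ ∑ i, c i ∧ ∃ m : ∀ i, M i, (∀ i, m i ∈ F i v (c i)) ∧
            t = PiTensorProduct.tprod K m }) =
      ∑ i, mfMuMax K (M i) (F i) := by
  have hF' : ∀ i v, IsFil (F i v) := fun i v => (hF i).isFil v
  have hbdd := bddAbove_slopes fun v => tensorFil_isFil fun i => hF' i v
  have hne : ∀ i, { x : ℝ | ∃ N : Submodule K (M i), N ≠ ⊥ ∧
      x = mfMu K ↥N (fun v l => (F i v l).comap N.subtype) }.Nonempty :=
    fun i => ⟨_, ⊤, top_ne_bot, rfl⟩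
  refine le_antisymm (csSup_le ?_ ?_) (le_of_forall_pos_le_add fun ε hε => ?_)
  · obtain ⟨V, hV, -⟩ := exists_sum_slopes_le hF' (fun _ => ⊤) fun _ => top_ne_bot
    exact ⟨_, V, hV, rfl⟩
  · rintro _ ⟨V, hV, rfl⟩
    exact slope_le_sum_mfMuMax hF' hV
  · have hδ : 0 < ε / (k + 1) := by positivity
    choose s hs hlt using fun i => exists_lt_of_lt_csSup (hne i) (sub_lt_self _ hδ)
    choose N hN hsN using hs
    obtain ⟨V, hV, hle⟩ := exists_sum_slopes_le hF' N hN
    have hVle := le_csSup hbdd ⟨V, hV, rfl⟩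
    have hsum : ∑ i, mfMuMax K (M i) (F i) ≤ ∑ i, (s i + ε / (k + 1)) :=
      Finset.sum_le_sum fun i _ => by
        have := hlt i
        rw [mfMuMax]
        linarith
    have hs' : ∑ i, s i = ∑ i, mfMu K (N i) (fun v => inducedFil (F i v) (N i)) :=
      Finset.sum_congr rfl fun i _ => hsN i
    have hkε : (k : ℝ) * (ε / (k + 1)) ≤ ε := by
      rw [mul_div_assoc', div_le_iff₀ (by positivity)]
      nlinarith
    rw [Finset.sum_add_distrib, hs'] at hsum
    simp only [Finset.sum_const, Finset.card_univ, Fintype.card_fin, nsmul_eq_mul] at hsum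
    exact hsum.trans (add_le_add (hle.trans hVle) hkε)
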